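/- Let (l₁, …, l_p) be an affinely independent family of p > 1 affine functions ℝⁿ → ℝ such that max(l₁, …, l_p) has minimal depth m. If max(l₁, …, l_{p−1}) has minimal depth m*, then m* = m − 1 or m* = m. -/

import Mathlib

open Pointwise

noncomputable section

/-- `NN m n` is the set of functions `ℝⁿ → ℝ` representable by a ReLU neural network
with `m` hidden layers: `f = T⁽ᵐ⁺¹⁾ ∘ σ ∘ T⁽ᵐ⁾ ∘ σ ∘ ⋯ ∘ σ ∘ T⁽¹⁾` with each `T⁽ˡ⁾` affine
and `σ` the componentwise ReLU.  (`NN 0 n` is the set of affine functions.) -/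
def NN : ℕ → (n : ℕ) → Set ((Fin n → ℝ) → ℝ)
  | 0, n => {f | ∃ T : (Fin n → ℝ) →ᵃ[ℝ] ℝ, f = ⇑T}
  | m + 1, n => {f | ∃ (w : ℕ) (T : (Fin n → ℝ) →ᵃ[ℝ] (Fin w → ℝ)),
      ∃ g ∈ NN m w, f = fun x => g fun i => max (T x i) 0}

/-- Continuous piecewise linear functions `ℝⁿ → ℝ`: continuous functions that at each point
agree with one of finitely many affine functions. -/
def CPWL (n : ℕ) : Set ((Fin n → ℝ) → ℝ) :=
  {f | Continuous f ∧ ∃ s : Finset ((Fin n → ℝ) →ᵃ[ℝ] ℝ), ∀ x, ∃ g ∈ s, f x = g x}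

/-- `f` has minimal depth `m`: `f ∈ Υₙ(m)` and either `m = 0` or `f ∉ Υₙ(m-1)`. -/
def MinDepth (n : ℕ) (f : (Fin n → ℝ) → ℝ) (m : ℕ) : Prop :=
  f ∈ NN m n ∧ (m = 0 ∨ f ∉ NN (m - 1) n)

/-- `Mn n` is the least `m` such that `Υₙ = Υₙ(m)`. -/
def Mn (n : ℕ) : ℕ := sInf {m | CPWL n = NN m n}

theorem NN.comp_affine {m n k : ℕ} {f : (Fin n → ℝ) → ℝ} (hf : f ∈ NN m n)
    (A : (Fin k → ℝ) →ᵃ[ℝ] (Fin n → ℝ)) : (fun x => f (A x)) ∈ NN m k := by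
  cases m with
  | zero =>
    obtain ⟨T, rfl⟩ := hf
    exact ⟨T.comp A, rfl⟩
  | succ m =>
    obtain ⟨w, T, g, hg, rfl⟩ := hf
    exact ⟨w, T.comp A, g, hg, rfl⟩

theorem NN.add_affine {m n : ℕ} {f : (Fin n → ℝ) → ℝ} (hf : f ∈ NN m n)
    (l : (Fin n → ℝ) →ᵃ[ℝ] ℝ) : (fun x => f x + l x) ∈ NN m n := by
  induction m generalizing n with
  | zero =>
    obtain ⟨T, rfl⟩ := hf
    exact ⟨T + l, rfl⟩
  | succ m ih =>
    obtain ⟨w, T, g, hg, rfl⟩ := hf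
    let T' : (Fin n → ℝ) →ᵃ[ℝ] (Fin (w + 2) → ℝ) :=
      AffineMap.pi (Fin.append (fun i => (AffineMap.proj i).comp T) ![l, -l])
    let P : (Fin (w + 2) → ℝ) →ᵃ[ℝ] (Fin w → ℝ) :=
      AffineMap.pi fun i => AffineMap.proj (Fin.castAdd 2 i)
    let d : (Fin (w + 2) → ℝ) →ᵃ[ℝ] ℝ :=
      (LinearMap.proj (R := ℝ) (φ := fun _ => ℝ) (Fin.natAdd w (0 : Fin 2)) -
        LinearMap.proj (Fin.natAdd w (1 : Fin 2))).toAffineMap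
    refine ⟨w + 2, T', fun y => g (P y) + d y, ih (NN.comp_affine hg P) d, ?_⟩
    funext x
    have hP : P (fun i => max (T' x i) 0) = fun i => max (T x i) 0 := by
      funext i
      simp [P, T']
    have hd : d (fun i => max (T' x i) 0) = l x := by
      have h : d (fun i => max (T' x i) 0) = max (l x) 0 - max (-l x) 0 := by
        simp only [d, T', LinearMap.coe_toAffineMap, LinearMap.sub_apply,
          LinearMap.proj_apply, AffineMap.pi_apply, Fin.append_right]
        simp
      rw [h]
      rcases le_total (l x) 0 with h0 | h0
      · rw [max_eq_right h0, max_eq_left (by linarith)]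
        ring
      · rw [max_eq_left h0, max_eq_right (by linarith)]
        ring
    simp only [hP, hd]

theorem NN.relu {m n : ℕ} {f : (Fin n → ℝ) → ℝ} (hf : f ∈ NN m n) :
    (fun x => max (f x) 0) ∈ NN (m + 1) n := by
  induction m generalizing n with
  | zero =>
    obtain ⟨T, rfl⟩ := hf
    exact ⟨1, AffineMap.pi fun _ => T, _, ⟨AffineMap.proj 0, rfl⟩, rfl⟩
  | succ m ih =>
    obtain ⟨w, T, g, hg, rfl⟩ := hf
    exact ⟨w, T, _, ih hg, rfl⟩

theorem NN.subset_succ (m n : ℕ) : NN m n ⊆ NN (m + 1) n := by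
  intro f hf
  induction m generalizing n with
  | zero =>
    obtain ⟨T, rfl⟩ := hf
    have h0 : (fun _ => 0 : (Fin n → ℝ) → ℝ) ∈ NN 0 n := ⟨AffineMap.const ℝ _ 0, rfl⟩
    simpa using NN.add_affine (NN.relu h0) T
  | succ m ih =>
    obtain ⟨w, T, g, hg, rfl⟩ := hf
    exact ⟨w, T, g, ih w hg, rfl⟩

theorem NN.monotone (n : ℕ) : Monotone fun m => NN m n :=
  monotone_nat_of_le_succ fun m => NN.subset_succ m n

theorem MinDepth.le_of_mem {n m k : ℕ} {f : (Fin n → ℝ) → ℝ} (h : MinDepth n f m)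
    (hk : f ∈ NN k n) : m ≤ k := by
  by_contra! hlt
  rcases h.2 with h0 | h0
  · omega
  · exact h0 (NN.monotone n (show k ≤ m - 1 by omega) hk)

/-- The affine function `x ↦ a · x + c`. -/
def affineForm {n : ℕ} (a : Fin n → ℝ) (c : ℝ) : (Fin n → ℝ) →ᵃ[ℝ] ℝ :=
  (∑ j, a j • LinearMap.proj j : (Fin n → ℝ) →ₗ[ℝ] ℝ).toAffineMap + AffineMap.const ℝ _ c

theorem affineForm_apply {n : ℕ} (a : Fin n → ℝ) (c : ℝ) (x : Fin n → ℝ) :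
    affineForm a c x = (∑ j, a j * x j) + c := by
  simp [affineForm]

theorem ciSup_fin_succ_eq_max {k : ℕ} (f : Fin (k + 2) → ℝ) :
    ⨆ i, f i = max (⨆ i : Fin (k + 1), f i.castSucc) (f (Fin.last (k + 1))) := by
  apply le_antisymm
  · refine ciSup_le fun i => ?_
    induction i using Fin.lastCases with
    | last => exact le_max_right _ _
    | cast i =>
      exact le_max_of_le_left
        (le_ciSup (f := fun i : Fin (k + 1) => f i.castSucc) (Set.finite_range _).bddAbove i)
  · exact max_le (ciSup_le fun i => le_ciSup (Set.finite_range f).bddAbove i.castSucc)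
      (le_ciSup (Set.finite_range f).bddAbove _)

/-- Some direction separates one point of an affinely independent family from all the others,
on which the corresponding linear form is constant. -/
theorem AffineIndependent.exists_direction {ι : Type*} {n : ℕ} {a : ι → Fin n → ℝ}
    (ha : AffineIndependent ℝ a) {i₀ i₁ : ι} (h : i₁ ≠ i₀) :
    ∃ v : Fin n → ℝ, (∑ j, a i₁ j * v j) = (∑ j, a i₀ j * v j) + 1 ∧
      ∀ i, i ≠ i₁ → (∑ j, a i j * v j) = ∑ j, a i₀ j * v j := by
  classical
  have hli := (affineIndependent_iff_linearIndependent_vsub ℝ a i₀).1 ha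
  obtain ⟨g, hg⟩ := LinearMap.exists_leftInverse_of_injective _ (LinearMap.ker_eq_bot.2 hli)
  let φ : (Fin n → ℝ) →ₗ[ℝ] ℝ := (Finsupp.lapply ⟨i₁, h⟩) ∘ₗ g
  have hφ (i : {x // x ≠ i₀}) : φ (a i - a i₀) = if i.1 = i₁ then 1 else 0 := by
    have := LinearMap.congr_fun hg (Finsupp.single i 1)
    simp only [LinearMap.comp_apply, Finsupp.linearCombination_single, one_smul, vsub_eq_sub,
      LinearMap.id_apply] at this
    simp [φ, this, Finsupp.single_apply, Subtype.ext_iff]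
  have hsum (b : Fin n → ℝ) : (∑ j, b j * φ (Pi.single j 1)) = φ b := by
    rw [LinearMap.pi_apply_eq_sum_univ φ b]
    simp only [smul_eq_mul]
    refine Finset.sum_congr rfl fun j _ => ?_
    congr 2
    funext k
    simp [Pi.single_apply, eq_comm]
  refine ⟨fun j => φ (Pi.single j 1), ?_, fun i hi => ?_⟩
  · have := hφ ⟨i₁, h⟩
    rw [map_sub, if_pos rfl] at this
    rw [hsum, hsum]
    linarith
  · rw [hsum, hsum]
    by_cases hi₀ : i = i₀
    · rw [hi₀]
    · have := hφ ⟨i, hi₀⟩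
      rw [map_sub, if_neg hi] at this
      linarith

theorem NN.iSup_succ_mem {n k m : ℕ} (L : Fin (k + 2) → (Fin n → ℝ) →ᵃ[ℝ] ℝ)
    (h : (fun x => ⨆ i : Fin (k + 1), L i.castSucc x) ∈ NN m n) :
    (fun x => ⨆ i, L i x) ∈ NN (m + 1) n := by
  convert NN.add_affine (NN.relu (NN.add_affine h (-L (Fin.last _)))) (L (Fin.last _)) using 2
    with x
  rw [ciSup_fin_succ_eq_max, ← max_add_add_right]
  simp

theorem NN.iSup_castSucc_mem {n k m : ℕ} {a : Fin (k + 2) → Fin n → ℝ}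
    (ha : AffineIndependent ℝ a) (c : Fin (k + 2) → ℝ)
    (h : (fun x => ⨆ i, affineForm (a i) (c i) x) ∈ NN m n) :
    (fun x => ⨆ i : Fin (k + 1), affineForm (a i.castSucc) (c i.castSucc) x) ∈ NN m n := by
  set L := fun i => affineForm (a i) (c i) with hL
  obtain ⟨v, hv₁, hv⟩ := ha.exists_direction (i₀ := 0) (i₁ := Fin.last (k + 1))
    (Fin.last_pos.ne')
  let A : (Fin n → ℝ) →ᵃ[ℝ] (Fin n → ℝ) :=
    AffineMap.id ℝ _ - AffineMap.pi fun j => v j • (L (Fin.last _) - L 0)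
  have hLA (i) (x) : L i (A x) = L i x - (∑ j, a i j * v j) * (L (Fin.last _) x - L 0 x) := by
    have hA (j) : A x j = x j - v j * (L (Fin.last _) x - L 0 x) := by simp [A]
    simp only [hL, affineForm_apply] at hA ⊢
    simp only [hA, mul_sub, Finset.sum_sub_distrib, Finset.sum_mul, mul_assoc]
    ring
  convert NN.add_affine (NN.comp_affine h A) (L 0 - (L 0).comp A) using 2 with x
  have hcast (i : Fin (k + 1)) : L i.castSucc (A x) = L i.castSucc x + (L 0 (A x) - L 0 x) := by
    rw [hLA, hLA, hv _ (Fin.castSucc_lt_last i).ne]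
    ring
  have hlast : L (Fin.last _) (A x) = L 0 (A x) := by
    rw [hLA, hLA, hv₁]
    ring
  have hle : L 0 (A x) ≤ ⨆ i : Fin (k + 1), L i.castSucc (A x) :=
    le_ciSup (f := fun i : Fin (k + 1) => L i.castSucc (A x)) (Set.finite_range _).bddAbove 0
  have hsup : ⨆ i, L i (A x) = (⨆ i : Fin (k + 1), L i.castSucc x) + (L 0 (A x) - L 0 x) := by
    rw [ciSup_fin_succ_eq_max, hlast, max_eq_left hle, ciSup_add (Set.finite_range _).bddAbove]
    simp only [hcast]
  change (⨆ i : Fin (k + 1), L i.castSucc x) = (⨆ i, L i (A x)) + (L 0 x - L 0 (A x))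
  rw [hsup]
  ring

/-- For an affinely independent family of `p > 1` affine functions
`lᵢ(x) = aᵢ·x + cᵢ`, if `max(l₁, …, l_p)` has minimal depth `m` and `max(l₁, …, l_{p-1})`
has minimal depth `m*`, then `m* = m - 1` or `m* = m`. -/
theorem statement11 (n p : ℕ) (hp : 1 < p)
    (a : Fin p → Fin n → ℝ) (c : Fin p → ℝ)
    (ha : AffineIndependent ℝ a) (m mstar : ℕ)
    (hm : MinDepth n (fun x => ⨆ i, ((∑ j, a i j * x j) + c i)) m)
    (hmstar : MinDepth n
      (fun x => ⨆ i : Fin (p - 1),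
        ((∑ j, a (Fin.castLE (Nat.sub_le p 1) i) j * x j) +
          c (Fin.castLE (Nat.sub_le p 1) i))) mstar) :
    mstar = m - 1 ∨ mstar = m := by
  obtain ⟨k, rfl⟩ : ∃ k, p = k + 2 := ⟨p - 2, by omega⟩
  simp only [← affineForm_apply] at hm hmstar
  have hle : mstar ≤ m := hmstar.le_of_mem (NN.iSup_castSucc_mem ha c hm.1)
  have hge : m ≤ mstar + 1 :=
    hm.le_of_mem (NN.iSup_succ_mem (fun i => affineForm (a i) (c i)) hmstar.1)
  omega
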